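/- Let x̄ ∈ Ω, let the family {g_t}_{t∈T} be uniformly strictly differentiable at x̄, and suppose that both the PMFCQ and the NFMCQ hold at x̄. Then the limiting normal cone is computed without closure: N(x̄; Ω) = cone{∇g_t(x̄) : t ∈ T(x̄)} + ∇h(x̄)*(Y*). -/

import Mathlib

open Filter Topology Set Pointwise

section Defs

variable {X : Type*} [NormedAddCommGroup X] [NormedSpace ℝ X]

/-- The canonical identification of the dual of `X` with its weak* dual. -/
def toWD (p : X →L[ℝ] ℝ) : WeakDual ℝ X := p

/-- The weak* closure of a subset of the dual. -/
def wkClosure (S : Set (X →L[ℝ] ℝ)) : Set (X →L[ℝ] ℝ) :=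
  {p | toWD p ∈ closure (toWD '' S)}

/-- A subset of the dual is weak* closed. -/
def IsWeakStarClosed (S : Set (X →L[ℝ] ℝ)) : Prop :=
  IsClosed (toWD '' S)

/-- A subset of `X* × ℝ` is weak* closed. -/
def IsWeakStarClosedProd (S : Set ((X →L[ℝ] ℝ) × ℝ)) : Prop :=
  IsClosed ((fun p : (X →L[ℝ] ℝ) × ℝ => (toWD p.1, p.2)) '' S)

/-- The convex conic hull of `S ∪ {0}`: all finite nonnegative combinations of elements of `S`. -/
def coneHull {E : Type*} [AddCommMonoid E] [Module ℝ E] (S : Set E) : Set E :=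
  {x | ∃ (n : ℕ) (c : Fin n → ℝ) (v : Fin n → E),
    (∀ i, 0 ≤ c i) ∧ (∀ i, v i ∈ S) ∧ x = ∑ i, c i • v i}

/-- The set of ε-normals to `Ω` at `x`. -/
def epsNormal (Ω : Set X) (x : X) (ε : ℝ) : Set (X →L[ℝ] ℝ) :=
  {p | ∀ γ > (0:ℝ), ∃ δ > (0:ℝ), ∀ u ∈ Ω, ‖u - x‖ < δ → p (u - x) ≤ (ε + γ) * ‖u - x‖}

/-- The Fréchet (regular) normal cone to `Ω` at `x`. -/
def frechetNormal (Ω : Set X) (x : X) : Set (X →L[ℝ] ℝ) := epsNormal Ω x 0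

/-- The limiting (Mordukhovich) normal cone to `Ω` at `xb`. -/
def limitingNormal (Ω : Set X) (xb : X) : Set (X →L[ℝ] ℝ) :=
  {p | ∃ (ε : ℕ → ℝ) (xs : ℕ → X) (ps : ℕ → X →L[ℝ] ℝ),
    (∀ n, 0 ≤ ε n) ∧ Tendsto ε atTop (𝓝 0) ∧
    (∀ n, xs n ∈ Ω) ∧ Tendsto xs atTop (𝓝 xb) ∧
    (∀ n, ps n ∈ epsNormal Ω (xs n) (ε n)) ∧
    (∀ v : X, Tendsto (fun n => ps n v) atTop (𝓝 (p v)))}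

/-- The normal cone of convex analysis to `Ω` at `xb`. -/
def convexNormal (Ω : Set X) (xb : X) : Set (X →L[ℝ] ℝ) :=
  {p | ∀ x ∈ Ω, p (x - xb) ≤ 0}

/-- The subdifferential of convex analysis of `f` at `xb`. -/
def convexSubdiff (f : X → ℝ) (xb : X) : Set (X →L[ℝ] ℝ) :=
  {p | ∀ x, f xb + p (x - xb) ≤ f x}

variable {Y : Type*} [NormedAddCommGroup Y] [NormedSpace ℝ Y]

/-- The image `A*(Y*)` of the adjoint operator `A* : Y* → X*`. -/
def adjRange (A : X →L[ℝ] Y) : Set (X →L[ℝ] ℝ) :=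
  Set.range fun q : Y →L[ℝ] ℝ => q.comp A

variable {T : Type*}

/-- Uniform Fréchet differentiability of the family `g = (g t)` at `xb`:
`s(η) := sup_t sup_{x ∈ B_η(xb), x ≠ xb} |g t x - g t xb - ⟨dg t, x - xb⟩|/‖x - xb‖ → 0` as `η ↓ 0`. -/
def UnifFrechetDiffAt (g : T → X → ℝ) (dg : T → X →L[ℝ] ℝ) (xb : X) : Prop :=
  ∀ ε > (0:ℝ), ∃ η > (0:ℝ), ∀ t : T, ∀ x : X, ‖x - xb‖ ≤ η →
    |g t x - g t xb - dg t (x - xb)| ≤ ε * ‖x - xb‖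

/-- Uniform strict differentiability of the family `g = (g t)` at `xb`:
`r(η) := sup_t sup_{x,x' ∈ B_η(xb), x ≠ x'} |g t x - g t x' - ⟨dg t, x - x'⟩|/‖x - x'‖ → 0`
as `η ↓ 0`. -/
def UnifStrictDiffAt (g : T → X → ℝ) (dg : T → X →L[ℝ] ℝ) (xb : X) : Prop :=
  ∀ ε > (0:ℝ), ∃ η > (0:ℝ), ∀ t : T, ∀ x x' : X, ‖x - xb‖ ≤ η → ‖x' - xb‖ ≤ η →
    |g t x - g t x' - dg t (x - x')| ≤ ε * ‖x - x'‖

/-- The inequality part of the PMFCQ at `xb` with the direction `xt`: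
`inf_{ε>0} sup_{t ∈ T_ε(xb)} ⟨dg t, xt⟩ < 0`, where `T_ε(xb) = {t | g t xb ≥ -ε}`. -/
def PMFCQat (g : T → X → ℝ) (dg : T → X →L[ℝ] ℝ) (xb xt : X) : Prop :=
  ∃ ε > (0:ℝ), ∃ δ > (0:ℝ), ∀ t : T, -ε ≤ g t xb → dg t xt ≤ -δ

end Defs


section Helpers

lemma coneHull_add {E : Type*} [AddCommMonoid E] [Module ℝ E] {S : Set E} {x y : E}
    (hx : x ∈ coneHull S) (hy : y ∈ coneHull S) : x + y ∈ coneHull S := by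
  obtain ⟨n, c, v, hc, hv, rfl⟩ := hx
  obtain ⟨m, d, w, hd, hw, rfl⟩ := hy
  refine ⟨n + m, Fin.append c d, Fin.append v w, ?_, ?_, ?_⟩
  · intro i
    refine Fin.addCases (fun i => ?_) (fun i => ?_) i <;> simp [hc, hd]
  · intro i
    refine Fin.addCases (fun i => ?_) (fun i => ?_) i <;> simp [hv, hw]
  · simp [Fin.sum_univ_add]

lemma coneHull_smul {E : Type*} [AddCommMonoid E] [Module ℝ E] {S : Set E} {x : E} {a : ℝ}
    (ha : 0 ≤ a) (hx : x ∈ coneHull S) : a • x ∈ coneHull S := by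
  obtain ⟨n, c, v, hc, hv, rfl⟩ := hx
  exact ⟨n, fun i => a * c i, v, fun i => mul_nonneg ha (hc i), hv, by
    simp [Finset.smul_sum, mul_smul]⟩

lemma coneHull_sub {E : Type*} [AddCommMonoid E] [Module ℝ E] {S : Set E} {x : E}
    (hx : x ∈ S) : x ∈ coneHull S :=
  ⟨1, fun _ => 1, fun _ => x, by simp, by simp [hx], by simp⟩

lemma coneHull_zero {E : Type*} [AddCommMonoid E] [Module ℝ E] (S : Set E) :
    (0 : E) ∈ coneHull S :=
  ⟨0, Fin.elim0, Fin.elim0, fun i => i.elim0, fun i => i.elim0, by simp⟩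

variable {X : Type*} [NormedAddCommGroup X] [NormedSpace ℝ X]

lemma weakDual_functional (f : WeakDual ℝ X →L[ℝ] ℝ) : ∃ v : X, ∀ p : WeakDual ℝ X, f p = p v := by
  obtain ⟨v, hv⟩ := LinearMap.dualEmbedding_surjective (topDualPairing ℝ X) f
  exact ⟨v, fun p => by rw [← hv]; rfl⟩

/-- Separation in `X* × ℝ` with the weak* topology. -/
lemma weakStar_sep {D : Set (WeakDual ℝ X × ℝ)} (hc : Convex ℝ D) (hcl : IsClosed D)
    (z : WeakDual ℝ X × ℝ) (hz : z ∉ D) :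
    ∃ (v : X) (a u : ℝ), (∀ d ∈ D, d.1 v + a * d.2 < u) ∧ u < z.1 v + a * z.2 := by
  have : LocallyConvexSpace ℝ (WeakDual ℝ X) :=
    (WeakDual.withSeminorms (𝕜 := ℝ) (E := X)).toLocallyConvexSpace
  obtain ⟨f, u, h1, h2⟩ := geometric_hahn_banach_closed_point hc hcl hz
  obtain ⟨v, hv⟩ := weakDual_functional (f.comp (ContinuousLinearMap.inl ℝ (WeakDual ℝ X) ℝ))
  have key : ∀ d : WeakDual ℝ X × ℝ, f d = d.1 v + f (0, 1) * d.2 := by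
    intro d
    have e : d = (d.1, 0) + d.2 • ((0, 1) : WeakDual ℝ X × ℝ) := by ext <;> simp
    have := hv d.1
    simp only [ContinuousLinearMap.comp_apply, ContinuousLinearMap.inl_apply] at this
    conv_lhs => rw [e, map_add, map_smul, this]
    rw [smul_eq_mul, mul_comm]
  refine ⟨v, f (0, 1), u, fun d hd => ?_, ?_⟩
  · rw [← key]; exact h1 d hd
  · rw [← key]; exact h2

variable {Y : Type*} [NormedAddCommGroup Y] [NormedSpace ℝ Y]

lemma mem_adjRange_iff [CompleteSpace X] [CompleteSpace Y] (A : X →L[ℝ] Y)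
    (hA : Function.Surjective A) (p : X →L[ℝ] ℝ) :
    p ∈ adjRange A ↔ ∀ v, A v = 0 → p v = 0 := by
  constructor
  · rintro ⟨q, rfl⟩ v hv
    simp [hv]
  · intro H
    obtain ⟨C, hC, hex⟩ := A.exists_preimage_norm_le hA
    choose s hs hsn using hex
    have H2 : ∀ v w, A v = A w → p v = p w := fun v w hvw => by
      have := H (v - w) (by simp [hvw])
      rw [map_sub] at this; linarith
    let q : Y →ₗ[ℝ] ℝ :=
      { toFun := fun y => p (s y)
        map_add' := fun y z => by
          rw [← map_add]; apply H2; simp [hs]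
        map_smul' := fun a y => by
          rw [RingHom.id_apply, ← map_smul]; apply H2; simp [hs] }
    refine ⟨q.mkContinuous (‖p‖ * C) fun y => ?_, ?_⟩
    · calc ‖p (s y)‖ ≤ ‖p‖ * ‖s y‖ := p.le_opNorm _
        _ ≤ ‖p‖ * (C * ‖y‖) := by gcongr; exact hsn y
        _ = _ := by ring
    · ext v
      exact H2 _ _ (hs _)

/-- The closed subspace `{(q ∘ A, q (A x))}`. -/
lemma isClosed_adj (A : X →L[ℝ] Y) (xb : X) :
    IsClosed {d : WeakDual ℝ X × ℝ | (∀ v, A v = 0 → d.1 v = 0) ∧ d.2 = d.1 xb} := by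
  have ev : ∀ v, Continuous fun d : WeakDual ℝ X × ℝ => d.1 v := fun v =>
    (WeakDual.eval_continuous v).comp continuous_fst
  have : {d : WeakDual ℝ X × ℝ | (∀ v, A v = 0 → d.1 v = 0) ∧ d.2 = d.1 xb} =
      (⋂ v, ⋂ (_ : A v = 0), {d : WeakDual ℝ X × ℝ | d.1 v = 0}) ∩
        {d : WeakDual ℝ X × ℝ | d.2 = d.1 xb} := by
    ext d; simp
  rw [this]
  refine IsClosed.inter ?_ (isClosed_eq continuous_snd (ev xb))
  exact isClosed_iInter fun v => isClosed_iInter fun _ => isClosed_eq (ev v) continuous_const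

/-- Closed cone plus closed subspace, with a coercive functional on the cone. -/
lemma isClosed_cone_add {C L : Set (WeakDual ℝ X × ℝ)} (hC : IsClosed C) (hL : IsClosed L)
    (φ : WeakDual ℝ X × ℝ → ℝ) (hφ : Continuous φ)
    (hφa : ∀ c ∈ C, ∀ l ∈ L, φ (c + l) = φ c)
    (hbd : ∀ R : ℝ, ∃ B : ℝ, ∀ c ∈ C, φ c ≤ R → ‖WeakDual.toStrongDual c.1‖ ≤ B ∧ |c.2| ≤ B) :
    IsClosed (C + L) := by
  rw [← closure_subset_iff_isClosed]
  intro z hz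
  obtain ⟨B, hB⟩ := hbd (φ z + 1)
  set CR := C ∩ {c | φ c ≤ φ z + 1} with hCR
  have hcomp : IsCompact CR := by
    refine IsCompact.of_isClosed_subset
      ((WeakDual.isCompact_closedBall (𝕜 := ℝ) (E := X) 0 B).prod
        (isCompact_closedBall (0 : ℝ) B)) (hC.inter (isClosed_le hφ continuous_const)) ?_
    rintro c ⟨hc, hc2⟩
    obtain ⟨h1, h2⟩ := hB c hc hc2
    refine ⟨?_, ?_⟩
    · simpa using h1
    · simpa using h2
  have hcl : IsClosed (CR + L) := hL.add_left_of_isCompact hcomp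
  have hsub : (C + L) ∩ {c | φ c < φ z + 1} ⊆ CR + L := by
    rintro _ ⟨⟨c, hc, l, hl, rfl⟩, hlt⟩
    refine ⟨c, ⟨hc, ?_⟩, l, hl, rfl⟩
    have := hφa c hc l hl
    simp only [mem_ofPred_eq] at hlt ⊢
    linarith
  have hz2 : z ∈ closure ((C + L) ∩ {c | φ c < φ z + 1}) := by
    have ho : IsOpen {c | φ c < φ z + 1} := isOpen_lt hφ continuous_const
    rw [inter_comm]
    exact ho.inter_closure ⟨by simp, hz⟩
  have hz3 : z ∈ CR + L := (closure_minimal hsub hcl) hz2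
  exact Set.add_subset_add_right inter_subset_left hz3

end Helpers

section Helpers2
variable {X Y T : Type*} [NormedAddCommGroup X] [NormedSpace ℝ X] [CompleteSpace X]
    [NormedAddCommGroup Y] [NormedSpace ℝ Y] [CompleteSpace Y]

/-- Feasible arcs: uniform Lyusternik-type statement around `xb`. -/
lemma feasible_arc (g : T → X → ℝ) (dg : T → X →L[ℝ] ℝ) (h : X → Y) (dh : X →L[ℝ] Y) (xb : X)
    (hhd : HasStrictFDerivAt h dh xb) (M : ℝ) (hM : ∀ t : T, ‖dg t‖ ≤ M) (hM0 : 0 ≤ M)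
    (hunif : UnifStrictDiffAt g dg xb) (hsurj : Function.Surjective dh)
    (w : X) (hw : dh w = 0) (ε δ : ℝ) (hε : 0 < ε) (hδ : 0 < δ)
    (hwg : ∀ t : T, -ε ≤ g t xb → dg t w ≤ -δ) (ρ : ℝ) (hρ : 0 < ρ) (hρM : M * ρ ≤ δ / 2) :
    ∃ η > (0:ℝ), ∀ x, h x = 0 → (∀ t, g t x ≤ 0) → ‖x - xb‖ < η → ∀ τ, 0 < τ → τ < η →
      ∃ u, (h u = 0 ∧ ∀ t, g t u ≤ 0) ∧ ‖u - x - τ • w‖ ≤ ρ * τ := by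
  have hrange : dh.range = ⊤ := LinearMap.range_eq_top.2 hsurj
  set N := dh.nonlinearRightInverseOfSurjective hrange with hN
  have hNpos : 0 < N.nnnorm := dh.nonlinearRightInverseOfSurjective_nnnorm_pos hrange
  have hNpos' : (0:ℝ) < N.nnnorm := hNpos
  set W := ‖w‖ with hW
  have hW0 : 0 ≤ W := norm_nonneg _
  -- constants
  set c : ℝ := (N.nnnorm : ℝ)⁻¹ * ρ / (W + ρ) with hcdef
  have hc : 0 < c := by positivity
  have hcW : c * (W + ρ) = (N.nnnorm : ℝ)⁻¹ * ρ := by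
    rw [hcdef]; field_simp
  obtain ⟨s, hs, happ⟩ := hhd.approximates_deriv_on_nhds (c := ⟨c, hc.le⟩) (Or.inr hc)
  obtain ⟨r, hr, hrs⟩ := Metric.mem_nhds_iff.1 hs
  obtain ⟨η₁, hη₁, H1⟩ := hunif (δ / (2 * (W + ρ))) (by positivity)
  obtain ⟨η₂, hη₂, H2⟩ := hunif 1 one_pos
  set m := min (min r η₁) (min η₂ (ε / (M + 1))) with hm
  have hm0 : 0 < m := by
    have : 0 < ε / (M + 1) := by positivity
    simp only [hm, lt_min_iff]; exact ⟨⟨hr, hη₁⟩, hη₂, this⟩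
  have hmr : m ≤ r := (min_le_left _ _).trans (min_le_left _ _)
  have hm1 : m ≤ η₁ := (min_le_left _ _).trans (min_le_right _ _)
  have hm2 : m ≤ η₂ := (min_le_right _ _).trans (min_le_left _ _)
  have hm3 : m ≤ ε / (M + 1) := (min_le_right _ _).trans (min_le_right _ _)
  set η := m / (2 + W + ρ) with hη
  have hη0 : 0 < η := by positivity
  have hηm : η * (2 + W + ρ) = m := by rw [hη]; field_simp
  refine ⟨η, hη0, fun x hx0 hxg hxη τ hτ hτη => ?_⟩
  have hbnd : ∀ y, ‖y - (x + τ • w)‖ ≤ ρ * τ → ‖y - x‖ ≤ τ * (W + ρ) := by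
    intro y hy
    have : y - x = (y - (x + τ • w)) + τ • w := by abel
    rw [this]
    refine (norm_add_le _ _).trans ?_
    rw [norm_smul, Real.norm_of_nonneg hτ.le]; nlinarith
  have hbnd2 : ∀ y, ‖y - (x + τ • w)‖ ≤ ρ * τ → ‖y - xb‖ < m := by
    intro y hy
    have h1 := hbnd y hy
    have : y - xb = (y - x) + (x - xb) := by abel
    rw [this]
    refine (norm_add_le _ _).trans_lt ?_
    have : τ * (W + ρ) ≤ η * (W + ρ) := by gcongr
    nlinarith
  have hρτ : 0 ≤ ρ * τ := by positivity
  have hball : Metric.closedBall (x + τ • w) (ρ * τ) ⊆ s := by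
    intro y hy
    apply hrs
    rw [mem_closedBall_iff_norm] at hy
    rw [mem_ball_iff_norm]
    exact (hbnd2 y hy).trans_le hmr
  have hxm : ‖x - xb‖ < m := by nlinarith
  have hxs : x ∈ s := hrs (by rw [mem_ball_iff_norm]; linarith)
  have hsj := happ.surjOn_closedBall_of_nonlinearRightInverse N hρτ hball
  have hb : ‖h (x + τ • w)‖ ≤ c * (τ * W) := by
    have := happ _ (hball (Metric.mem_closedBall_self hρτ)) _ hxs
    simp only [add_sub_cancel_left, hx0, map_smul, hw, smul_zero, sub_zero] at this
    rw [norm_smul, Real.norm_of_nonneg hτ.le] at this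
    exact this
  obtain ⟨u, hu, hu0⟩ := hsj (show (0 : Y) ∈ _ by
    rw [mem_closedBall_iff_norm, zero_sub, norm_neg]
    refine hb.trans ?_
    change c * (τ * W) ≤ ((N.nnnorm : ℝ)⁻¹ - c) * (ρ * τ)
    have : ((N.nnnorm : ℝ)⁻¹ - c) * (ρ * τ) = ((N.nnnorm : ℝ)⁻¹ * ρ) * τ - c * ρ * τ := by ring
    rw [this, ← hcW]
    apply le_of_eq; ring)
  rw [mem_closedBall_iff_norm] at hu
  have hux := hbnd u hu
  have hum := hbnd2 u hu
  refine ⟨u, ⟨hu0, fun t => ?_⟩, by rwa [sub_sub]⟩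
  by_cases ht : -ε ≤ g t xb
  · have h1 := (abs_le.1 (H1 t u x (hum.le.trans hm1) (hxm.le.trans hm1))).2
    have h2 : dg t (u - x) ≤ -(τ * δ) + M * (ρ * τ) := by
      have e : u - x = τ • w + (u - (x + τ • w)) := by abel
      rw [e, map_add, map_smul, smul_eq_mul]
      have h3 : dg t (u - (x + τ • w)) ≤ M * (ρ * τ) :=
        (le_abs_self _).trans (((dg t).le_opNorm _).trans
          (mul_le_mul (hM t) hu (norm_nonneg _) hM0))
      have h4 := hwg t ht
      nlinarith
    have h5 : δ / (2 * (W + ρ)) * ‖u - x‖ ≤ δ / 2 * τ := by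
      calc _ ≤ δ / (2 * (W + ρ)) * (τ * (W + ρ)) := by gcongr
        _ = _ := by field_simp
    have h6 := hxg t
    have h7 : M * (ρ * τ) ≤ δ / 2 * τ := by
      rw [← mul_assoc]; exact mul_le_mul_of_nonneg_right hρM hτ.le
    linarith
  · have h1 := (abs_le.1 (H2 t u xb (hum.le.trans hm2) (by simpa using hη₂.le))).2
    have h3 : dg t (u - xb) ≤ M * ‖u - xb‖ :=
        (le_abs_self _).trans (((dg t).le_opNorm _).trans (by gcongr; exact hM t))
    have h4 : ‖u - xb‖ * (M + 1) ≤ ε := by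
      rw [← le_div_iff₀ (by positivity)]; linarith
    have h5 := not_le.1 ht
    linarith

lemma limiting_le_zero (g : T → X → ℝ) (dg : T → X →L[ℝ] ℝ) (h : X → Y) (dh : X →L[ℝ] Y) (xb : X)
    (hhd : HasStrictFDerivAt h dh xb) (M : ℝ) (hM : ∀ t : T, ‖dg t‖ ≤ M) (hM0 : 0 ≤ M)
    (hunif : UnifStrictDiffAt g dg xb) (hsurj : Function.Surjective dh)
    (w : X) (hw : dh w = 0) (ε δ : ℝ) (hε : 0 < ε) (hδ : 0 < δ)
    (hwg : ∀ t : T, -ε ≤ g t xb → dg t w ≤ -δ) (p : X →L[ℝ] ℝ)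
    (hp : p ∈ limitingNormal {x : X | h x = 0 ∧ ∀ t : T, g t x ≤ 0} xb) : p w ≤ 0 := by
  obtain ⟨e, xs, ps, he0, he, hxs, hxt, hps, hpt⟩ := hp
  obtain ⟨B, hB⟩ : ∃ B, ∀ n, ‖ps n‖ ≤ B := by
    apply banach_steinhaus
    intro v
    obtain ⟨C, hC⟩ := (hpt v).norm.bddAbove_range
    exact ⟨C, fun i => hC ⟨i, rfl⟩⟩
  have hB0 : 0 ≤ B := (norm_nonneg _).trans (hB 0)
  set W := ‖w‖ with hW
  have hW0 : 0 ≤ W := norm_nonneg _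
  have key : ∀ ρ, 0 < ρ → M * ρ ≤ δ / 2 → p w ≤ (0 + ρ) * (W + ρ) + B * ρ := by
    intro ρ hρ hρM
    obtain ⟨η, hη, H⟩ := feasible_arc g dg h dh xb hhd M hM hM0 hunif hsurj w hw ε δ hε hδ hwg
      ρ hρ hρM
    have hev : ∀ᶠ n in atTop, ‖xs n - xb‖ < η := by
      have := hxt (Metric.ball_mem_nhds xb hη)
      filter_upwards [this] with n hn
      rw [mem_preimage, mem_ball_iff_norm] at hn; exact hn
    have hlim : Tendsto (fun n => (e n + ρ) * (W + ρ) + B * ρ) atTop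
        (𝓝 ((0 + ρ) * (W + ρ) + B * ρ)) :=
      ((he.add_const ρ).mul_const _).add_const _
    refine le_of_tendsto_of_tendsto (hpt w) hlim ?_
    filter_upwards [hev] with n hn
    obtain ⟨d, hd, hdn⟩ := hps n ρ hρ
    set τ := min (η / 2) (d / (2 * (W + ρ))) with hτ
    have hτ0 : 0 < τ := lt_min (by positivity) (by positivity)
    have hτη : τ < η := (min_le_left _ _).trans_lt (by linarith)
    have hτd : τ * (W + ρ) < d := by
      have : τ * (2 * (W + ρ)) ≤ d := by
        rw [← le_div_iff₀ (by positivity)]; exact min_le_right _ _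
      linarith
    obtain ⟨u, hu, hur⟩ := H (xs n) (hxs n).1 (hxs n).2 hn τ hτ0 hτη
    have hux : ‖u - xs n‖ ≤ τ * (W + ρ) := by
      have : u - xs n = (u - xs n - τ • w) + τ • w := by abel
      rw [this]
      refine (norm_add_le _ _).trans ?_
      rw [norm_smul, Real.norm_of_nonneg hτ0.le]; nlinarith
    have h1 := hdn u hu (hux.trans_lt hτd)
    have h2 : (e n + ρ) * ‖u - xs n‖ ≤ (e n + ρ) * (τ * (W + ρ)) :=
      mul_le_mul_of_nonneg_left hux (add_nonneg (he0 n) hρ.le)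
    have h3 : -(B * (ρ * τ)) ≤ ps n (u - xs n - τ • w) := by
      have := ((ps n).le_opNorm (u - xs n - τ • w)).trans
        (mul_le_mul (hB n) hur (norm_nonneg _) hB0)
      exact (abs_le.1 this).1
    rw [map_sub, map_smul, smul_eq_mul] at h3
    have h4 : τ * ps n w ≤ τ * ((e n + ρ) * (W + ρ) + B * ρ) := by nlinarith
    exact le_of_mul_le_mul_left h4 hτ0
  have hlim : Tendsto (fun ρ : ℝ => (0 + ρ) * (W + ρ) + B * ρ) (𝓝[>] 0)
      (𝓝 ((0 + 0) * (W + 0) + B * 0)) := by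
    have : Continuous fun ρ : ℝ => (0 + ρ) * (W + ρ) + B * ρ := by fun_prop
    exact (this.tendsto 0).mono_left nhdsWithin_le_nhds
  have : p w ≤ (0 + 0) * (W + 0) + B * 0 := by
    refine ge_of_tendsto hlim ?_
    have hs : Ioo (0:ℝ) (δ / (2 * (M + 1))) ∈ 𝓝[>] (0:ℝ) :=
      Ioo_mem_nhdsGT (by positivity)
    filter_upwards [hs] with ρ hρ
    refine key ρ hρ.1 ?_
    have h1 := hρ.1
    have : ρ * (2 * (M + 1)) < δ := by
      rw [← lt_div_iff₀ (by positivity)]; exact hρ.2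
    nlinarith
  simpa using this

lemma easy_incl {X Y T : Type*} [NormedAddCommGroup X] [NormedSpace ℝ X]
    [NormedAddCommGroup Y] [NormedSpace ℝ Y] (g : T → X → ℝ) (dg : T → X →L[ℝ] ℝ) (h : X → Y) (dh : X →L[ℝ] Y) (xb : X)
    (hgd : ∀ t : T, HasFDerivAt (g t) (dg t) xb)
    (hhd : HasStrictFDerivAt h dh xb)
    (hxb : xb ∈ {x : X | h x = 0 ∧ ∀ t : T, g t x ≤ 0}) (p : X →L[ℝ] ℝ)
    (hp : p ∈ coneHull (dg '' {t : T | g t xb = 0}) + adjRange dh) :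
    p ∈ limitingNormal {x : X | h x = 0 ∧ ∀ t : T, g t x ≤ 0} xb := by
  have hadd : ∀ a b : X →L[ℝ] ℝ, a ∈ frechetNormal {x : X | h x = 0 ∧ ∀ t : T, g t x ≤ 0} xb →
      b ∈ frechetNormal {x : X | h x = 0 ∧ ∀ t : T, g t x ≤ 0} xb →
      a + b ∈ frechetNormal {x : X | h x = 0 ∧ ∀ t : T, g t x ≤ 0} xb := by
    intro a b ha hb γ hγ
    obtain ⟨d1, hd1, H1⟩ := ha (γ / 2) (by positivity)
    obtain ⟨d2, hd2, H2⟩ := hb (γ / 2) (by positivity)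
    refine ⟨min d1 d2, lt_min hd1 hd2, fun u hu hud => ?_⟩
    have h1 := H1 u hu (hud.trans_le (min_le_left _ _))
    have h2 := H2 u hu (hud.trans_le (min_le_right _ _))
    rw [add_apply]; nlinarith
  have hdgN : ∀ t, g t xb = 0 → ∀ c : ℝ, 0 ≤ c →
      c • dg t ∈ frechetNormal {x : X | h x = 0 ∧ ∀ t : T, g t x ≤ 0} xb := by
    intro t ht c hc γ hγ
    have := (hgd t).isLittleO.def (c := γ / (c + 1)) (by positivity)
    obtain ⟨d, hd, H⟩ := Metric.eventually_nhds_iff.1 this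
    refine ⟨d, hd, fun u hu hud => ?_⟩
    have h1 := H (by rwa [dist_eq_norm])
    rw [ht, Real.norm_eq_abs] at h1
    have h2 := (abs_le.1 h1).1
    have h3 := hu.2 t
    have h4 : dg t (u - xb) ≤ γ / (c + 1) * ‖u - xb‖ := by linarith
    have h5 : c * (γ / (c + 1)) ≤ γ := by
      rw [← mul_div_assoc, div_le_iff₀ (by positivity)]; nlinarith
    rw [smul_apply, smul_eq_mul, zero_add]
    calc c * dg t (u - xb) ≤ c * (γ / (c + 1) * ‖u - xb‖) := by gcongr
      _ = c * (γ / (c + 1)) * ‖u - xb‖ := by ring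
      _ ≤ γ * ‖u - xb‖ := by gcongr
  have hq : ∀ q : Y →L[ℝ] ℝ,
      q.comp dh ∈ frechetNormal {x : X | h x = 0 ∧ ∀ t : T, g t x ≤ 0} xb := by
    intro q γ hγ
    have := hhd.hasFDerivAt.isLittleO.def (c := γ / (‖q‖ + 1)) (by positivity)
    obtain ⟨d, hd, H⟩ := Metric.eventually_nhds_iff.1 this
    refine ⟨d, hd, fun u hu hud => ?_⟩
    have h1 := H (by rwa [dist_eq_norm])
    rw [hu.1, hxb.1, sub_zero, zero_sub, norm_neg] at h1
    have h5 : ‖q‖ * (γ / (‖q‖ + 1)) ≤ γ := by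
      rw [← mul_div_assoc, div_le_iff₀ (by positivity)]; nlinarith [norm_nonneg q]
    rw [zero_add]
    calc q (dh (u - xb)) ≤ ‖q‖ * ‖dh (u - xb)‖ := (le_abs_self _).trans (q.le_opNorm _)
      _ ≤ ‖q‖ * (γ / (‖q‖ + 1) * ‖u - xb‖) := by gcongr
      _ = ‖q‖ * (γ / (‖q‖ + 1)) * ‖u - xb‖ := by ring
      _ ≤ γ * ‖u - xb‖ := by gcongr
  have h0 : (0 : X →L[ℝ] ℝ) ∈ frechetNormal {x : X | h x = 0 ∧ ∀ t : T, g t x ≤ 0} xb := by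
    simpa using hq 0
  have hpF : p ∈ frechetNormal {x : X | h x = 0 ∧ ∀ t : T, g t x ≤ 0} xb := by
    obtain ⟨_, ⟨n, c, v, hc, hv, rfl⟩, _, ⟨q, rfl⟩, rfl⟩ := hp
    refine hadd _ _ ?_ (hq q)
    refine Finset.sum_induction _ (fun a => a ∈ frechetNormal _ xb) hadd h0 fun i _ => ?_
    obtain ⟨t, ht, hti⟩ := hv i
    rw [← hti]
    exact hdgN t ht _ (hc i)
  exact ⟨fun _ => 0, fun _ => xb, fun _ => p, fun _ => le_rfl, tendsto_const_nhds, fun _ => hxb,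
    tendsto_const_nhds, fun _ => hpF, fun _ => tendsto_const_nhds⟩

end Helpers2

/-- under the standing assumptions, if `{g t}` is uniformly strictly
differentiable at `xb ∈ Ω` and both the PMFCQ and the NFMCQ hold at `xb`, then the limiting
normal cone to `Ω` at `xb` is computed without closure:
`N(xb; Ω) = cone{dg t : t ∈ T(xb)} + ∇h(xb)*(Y*)`. -/
theorem statement13 {X Y T : Type*} [NormedAddCommGroup X] [NormedSpace ℝ X] [CompleteSpace X]
    [NormedAddCommGroup Y] [NormedSpace ℝ Y] [CompleteSpace Y]
    (g : T → X → ℝ) (dg : T → X →L[ℝ] ℝ) (h : X → Y) (dh : X →L[ℝ] Y) (xb : X)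
    (hgd : ∀ t : T, HasFDerivAt (g t) (dg t) xb)
    (hhd : HasStrictFDerivAt h dh xb)
    (hbd : ∃ M : ℝ, ∀ t : T, ‖dg t‖ ≤ M)
    (hxb : xb ∈ {x : X | h x = 0 ∧ ∀ t : T, g t x ≤ 0})
    (hunif : UnifStrictDiffAt g dg xb)
    (hsurj : Function.Surjective dh)
    (hpmfcq : ∃ xt : X, dh xt = 0 ∧ PMFCQat g dg xb xt)
    (hnfmcq : IsWeakStarClosedProd (coneHull (Set.range fun t : T => (dg t, dg t xb - g t xb)))) :
    limitingNormal {x : X | h x = 0 ∧ ∀ t : T, g t x ≤ 0} xb =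
      coneHull (dg '' {t : T | g t xb = 0}) + adjRange dh := by
  obtain ⟨M₀, hM₀⟩ := hbd
  obtain ⟨xt, hxt, ε, hε, δ, hδ, hPM⟩ := hpmfcq
  -- a nonnegative bound on the derivatives
  set M := max M₀ 0 with hMdef
  have hM : ∀ t, ‖dg t‖ ≤ M := fun t => (hM₀ t).trans (le_max_left _ _)
  have hM0 : 0 ≤ M := le_max_right _ _
  refine Subset.antisymm (fun p hp => ?_)
    (fun p hp => easy_incl g dg h dh xb hgd hhd hxb p hp)
  set G : Set ((X →L[ℝ] ℝ) × ℝ) := Set.range fun t : T => (dg t, dg t xb - g t xb) with hG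
  set C : Set (WeakDual ℝ X × ℝ) :=
    (fun p : (X →L[ℝ] ℝ) × ℝ => (toWD p.1, p.2)) '' coneHull G with hCdef
  have hCcl : IsClosed C := hnfmcq
  set L : Set (WeakDual ℝ X × ℝ) :=
    {d : WeakDual ℝ X × ℝ | (∀ v, dh v = 0 → d.1 v = 0) ∧ d.2 = d.1 xb} with hL
  have hLcl : IsClosed L := isClosed_adj dh xb
  -- the coercive functional
  set K : ℝ := (M * ‖xt‖ + δ) / ε with hK
  have hK0 : 0 < K := by positivity
  have hKε : K * ε = M * ‖xt‖ + δ := by rw [hK]; field_simp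
  have hcone : ∀ c ∈ coneHull G, 0 ≤ c.2 - c.1 xb ∧
      ‖c.1‖ * δ ≤ M * (-(c.1 xt) + K * (c.2 - c.1 xb)) := by
    rintro c ⟨n, l, v, hl, hv, rfl⟩
    refine Finset.sum_induction _ (fun c : (X →L[ℝ] ℝ) × ℝ => 0 ≤ c.2 - c.1 xb ∧
      ‖c.1‖ * δ ≤ M * (-(c.1 xt) + K * (c.2 - c.1 xb))) ?_ ?_ ?_
    · rintro a b ⟨ha1, ha2⟩ ⟨hb1, hb2⟩
      simp only [Prod.fst_add, Prod.snd_add, add_apply]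
      refine ⟨by linarith, ?_⟩
      have h1 : ‖a.1 + b.1‖ * δ ≤ (‖a.1‖ + ‖b.1‖) * δ := by gcongr; exact norm_add_le _ _
      nlinarith
    · simp
    · intro i _
      obtain ⟨t, ht⟩ := hv i
      rw [← ht]
      have hli := hl i
      have hgt := hxb.2 t
      simp only [Prod.smul_fst, Prod.smul_snd, smul_apply, smul_eq_mul,
        norm_smul, Real.norm_of_nonneg hli]
      have hφ : δ ≤ -(dg t xt) + K * (-(g t xb)) := by
        by_cases h1 : -ε ≤ g t xb
        · have := hPM t h1
          have : 0 ≤ K * (-(g t xb)) := mul_nonneg hK0.le (by linarith)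
          linarith
        · have h2 : dg t xt ≤ M * ‖xt‖ :=
            (le_abs_self _).trans (((dg t).le_opNorm _).trans (by gcongr; exact hM t))
          have : K * ε ≤ K * (-(g t xb)) := by gcongr; linarith
          linarith
      constructor
      · have : 0 ≤ l i * (-(g t xb)) := mul_nonneg hli (by linarith)
        linarith
      · have h3 : ‖dg t‖ * δ ≤ M * (-(dg t xt) + K * (-(g t xb))) :=
          mul_le_mul (hM t) hφ hδ.le hM0
        have := mul_le_mul_of_nonneg_left h3 hli
        linarith
  have ev : ∀ v, Continuous fun d : WeakDual ℝ X × ℝ => d.1 v := fun v =>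
    (WeakDual.eval_continuous v).comp continuous_fst
  have hDcl : IsClosed (C + L) := by
    refine isClosed_cone_add hCcl hLcl (fun d => -(d.1 xt) + K * (d.2 - d.1 xb)) ?_ ?_ ?_
    · exact (ev xt).neg.add (continuous_const.mul (continuous_snd.sub (ev xb)))
    · rintro c - l ⟨hl1, hl2⟩
      have h1 := hl1 xt hxt
      change -(c.1 xt + l.1 xt) + K * ((c.2 + l.2) - (c.1 xb + l.1 xb)) = _
      rw [h1, hl2]; ring
    · intro R
      refine ⟨max (M * R / δ) ((R + M * R / δ * ‖xt‖) / K + M * R / δ * ‖xb‖), ?_⟩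
      rintro _ ⟨c, hc, rfl⟩ hcR
      change -(c.1 xt) + K * (c.2 - c.1 xb) ≤ R at hcR
      change ‖c.1‖ ≤ _ ∧ |c.2| ≤ _
      obtain ⟨h1, h2⟩ := hcone c hc
      have h3 : ‖c.1‖ ≤ M * R / δ := by
        rw [le_div_iff₀ hδ]
        exact h2.trans (by gcongr)
      refine ⟨h3.trans (le_max_left _ _), le_trans ?_ (le_max_right _ _)⟩
      have h4 : |c.1 xt| ≤ M * R / δ * ‖xt‖ := (c.1.le_opNorm _).trans (by gcongr)
      have h5 : |c.1 xb| ≤ M * R / δ * ‖xb‖ := (c.1.le_opNorm _).trans (by gcongr)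
      have h6 : c.2 - c.1 xb ≤ (R + M * R / δ * ‖xt‖) / K := by
        rw [le_div_iff₀ hK0]
        have := (abs_le.1 h4).2
        linarith
      have h7 := abs_le.1 h5
      rw [abs_le]
      constructor <;> linarith
  have hCconv : Convex ℝ C := by
    rintro _ ⟨c, hc, rfl⟩ _ ⟨d, hd, rfl⟩ a b ha hb _
    exact ⟨a • c + b • d, coneHull_add (coneHull_smul ha hc) (coneHull_smul hb hd), rfl⟩
  have hLsub : ∀ x ∈ L, ∀ y ∈ L, ∀ a b : ℝ, a • x + b • y ∈ L := by
    rintro x ⟨hx1, hx2⟩ y ⟨hy1, hy2⟩ a b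
    refine ⟨fun v hv => ?_, ?_⟩
    · change a * x.1 v + b * y.1 v = 0
      rw [hx1 v hv, hy1 v hv]; ring
    · change a * x.2 + b * y.2 = a * x.1 xb + b * y.1 xb
      rw [hx2, hy2]
  have hLconv : Convex ℝ L := fun x hx y hy a b _ _ _ => hLsub x hx y hy a b
  have hC0 : (0 : WeakDual ℝ X × ℝ) ∈ C := ⟨0, coneHull_zero G, rfl⟩
  have hL0 : (0 : WeakDual ℝ X × ℝ) ∈ L := ⟨fun v _ => rfl, rfl⟩
  by_cases hz : ((toWD p, p xb) : WeakDual ℝ X × ℝ) ∈ C + L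
  · -- the representation
    obtain ⟨_, ⟨c, hc, rfl⟩, l, ⟨hl1, hl2⟩, hcl⟩ := hz
    have e1 : ∀ v, c.1 v + l.1 v = p v := fun v => by
      have := congrArg (fun d : WeakDual ℝ X × ℝ => d.1 v) hcl
      exact this
    have e2 : c.2 + l.2 = p xb := congrArg (fun d : WeakDual ℝ X × ℝ => d.2) hcl
    have e3 : c.2 = c.1 xb := by have := e1 xb; linarith
    refine ⟨c.1, ?_, p - c.1, ?_, by simp⟩
    · obtain ⟨n, lam, v, hlam, hv, rfl⟩ := hc
      choose t ht using hv
      have ht1 : ∀ i, (v i).1 = dg (t i) := fun i => by rw [← ht i]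
      have ht2 : ∀ i, (v i).2 = dg (t i) xb - g (t i) xb := fun i => by rw [← ht i]
      have hsum : ∑ i, lam i * (-(g (t i) xb)) = 0 := by
        have e4 := e3
        simp only [Prod.fst_sum, Prod.snd_sum, Prod.smul_fst, Prod.smul_snd, ht1, ht2,
          sum_apply, smul_apply, smul_eq_mul] at e4
        rw [← sub_eq_zero, ← Finset.sum_sub_distrib] at e4
        rw [← e4]
        exact Finset.sum_congr rfl fun i _ => by ring
      have hz0 := (Finset.sum_eq_zero_iff_of_nonneg (fun i _ =>
        mul_nonneg (hlam i) (neg_nonneg.2 (hxb.2 (t i))))).1 hsum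
      simp only [Prod.fst_sum, Prod.smul_fst, ht1]
      refine Finset.sum_induction _ (fun a => a ∈ coneHull (dg '' {t : T | g t xb = 0}))
        (fun a b ha hb => coneHull_add ha hb) (coneHull_zero _) fun i hi => ?_
      rcases mul_eq_zero.1 (hz0 i hi) with h0 | h0
      · rw [h0, zero_smul]; exact coneHull_zero _
      · exact coneHull_smul (hlam i) (coneHull_sub ⟨t i, neg_eq_zero.1 h0, rfl⟩)
    · rw [mem_adjRange_iff dh hsurj]
      intro v hv
      have h1 := e1 v
      have h2 := hl1 v hv
      change p v - c.1 v = 0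
      linarith
  · -- separation
    exfalso
    obtain ⟨v, a, u, h1, h2⟩ := weakStar_sep (hCconv.add hLconv) hDcl _ hz
    change u < p v + a * p xb at h2
    have hu : 0 < u := by
      have := h1 _ (Set.add_mem_add hC0 hL0)
      have e : ((0 + 0 : WeakDual ℝ X × ℝ)).1 v + a * (0 + 0 : WeakDual ℝ X × ℝ).2 = 0 := by
        rw [add_zero]
        change (0:ℝ) + a * 0 = 0
        simp
      rwa [e] at this
    have arch : ∀ r : ℝ, (∀ s : ℝ, 0 ≤ s → s * r < u) → r ≤ 0 := by
      intro r hr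
      by_contra hr0
      push Not at hr0
      have := hr (u / r) (by positivity)
      rw [div_mul_cancel₀ _ hr0.ne'] at this
      exact lt_irrefl _ this
    have hdg : ∀ t, dg t (v + a • xb) ≤ a * g t xb := by
      intro t
      have h3 : dg t v + a * (dg t xb - g t xb) ≤ 0 := by
        refine arch _ fun s hs => ?_
        have hm : ((toWD (s • dg t), s * (dg t xb - g t xb)) : WeakDual ℝ X × ℝ) ∈ C :=
          ⟨s • (dg t, dg t xb - g t xb), coneHull_smul hs (coneHull_sub ⟨t, rfl⟩), rfl⟩
        have := h1 _ (Set.add_mem_add hm hL0)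
        rw [add_zero] at this
        change s * dg t v + a * (s * (dg t xb - g t xb)) < u at this
        linarith
      rw [map_add, map_smul, smul_eq_mul]
      linarith
    have hdh : dh (v + a • xb) = 0 := by
      have h3 : ∀ q : Y →L[ℝ] ℝ, q (dh (v + a • xb)) ≤ 0 := by
        intro q
        refine arch _ fun s hs => ?_
        have hm : ((toWD (s • q.comp dh), s * q (dh xb)) : WeakDual ℝ X × ℝ) ∈ L := by
          refine ⟨fun w hw => ?_, rfl⟩
          change s * q (dh w) = 0
          simp [hw]
        have := h1 _ (Set.add_mem_add hC0 hm)
        rw [zero_add] at this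
        change s * q (dh v) + a * (s * q (dh xb)) < u at this
        rw [map_add, map_smul, map_add, map_smul, smul_eq_mul]
        linarith
      refine NormedSpace.eq_zero_of_forall_dual_eq_zero ℝ fun q => ?_
      have h4 := h3 q
      have h5 := h3 (-q)
      rw [neg_apply] at h5
      linarith
    set w₀ := v + a • xb with hw₀
    have hpw₀ : 0 < p w₀ := by
      rw [hw₀, map_add, map_smul, smul_eq_mul]; linarith
    set s := p w₀ / (2 * (|p xt| + 1)) with hs
    have hs0 : 0 < s := by positivity
    have hs1 : s * (2 * (|p xt| + 1)) = p w₀ := by rw [hs]; field_simp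
    have hpw : 0 < p (w₀ + s • xt) := by
      rw [map_add, map_smul, smul_eq_mul]
      have : s * (-|p xt|) ≤ s * p xt := by gcongr; exact neg_abs_le _
      have : 0 ≤ s * |p xt| := by positivity
      linarith
    refine absurd (limiting_le_zero g dg h dh xb hhd M hM hM0 hunif hsurj (w₀ + s • xt) ?_
      (min ε (s * δ / (2 * (|a| + 1)))) (s * δ / 2) (lt_min hε (by positivity)) (by positivity)
      ?_ p hp) (not_le.2 hpw)
    · rw [map_add, map_smul, hdh, hxt]; simp
    · intro t ht
      have h3 : -ε ≤ g t xb := by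
        have := min_le_left ε (s * δ / (2 * (|a| + 1))); linarith
      have h4 : -(g t xb) ≤ s * δ / (2 * (|a| + 1)) := by
        have := min_le_right ε (s * δ / (2 * (|a| + 1))); linarith
      rw [le_div_iff₀ (by positivity)] at h4
      have h5 := hPM t h3
      have h6 := hdg t
      have hgt := hxb.2 t
      have h7 : a * g t xb ≤ |a| * (-(g t xb)) := by
        have : -|a| ≤ a := neg_abs_le a
        nlinarith
      have h8 : s * dg t xt ≤ s * (-δ) := by gcongr
      rw [map_add, map_smul, smul_eq_mul]
      linarith
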